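/- For α ∈ (0,2), the Fourier multiplier operator D^α with symbol (2π|ξ|)^α acting on Schwartz functions f on ℝⁿ satisfies D^α f(x) = lim_{ε→0} (1/c_{n,α}) ∫_{|y|≥ε} (f(x+y) - f(x))/|y|^{n+α} dy, where c_{n,α} = π^{n/2} 2^{-α} Γ(-α/2)/Γ((n+α)/2). -/

import Mathlib

open MeasureTheory Filter Real
open scoped FourierTransform Topology

/-- The fractional Laplacian `D^α = (-Δ)^{α/2}`, defined as the Fourier multiplier with
symbol `(2π|ξ|)^α`. -/
noncomputable def fracD {n : ℕ} (α : ℝ) (g : EuclideanSpace ℝ (Fin n) → ℂ) :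
    EuclideanSpace ℝ (Fin n) → ℂ :=
  𝓕⁻ (fun ξ => (((2 * Real.pi * ‖ξ‖) ^ α : ℝ) : ℂ) * 𝓕 g ξ)

theorem Gamma_neg_of_neg_one_lt_of_neg {a : ℝ} (ha : -1 < a) (ha0 : a < 0) :
    Real.Gamma a < 0 := by
  have h := Real.Gamma_add_one ha0.ne
  have := Real.Gamma_pos_of_pos (by linarith : 0 < a + 1)
  by_contra! hpos
  nlinarith

theorem lintegral_rpow_mul_exp_neg_mul_Ioi {a r : ℝ} (ha : 0 < a) (hr : 0 < r) :
    ∫⁻ t in Set.Ioi (0 : ℝ), ENNReal.ofReal (t ^ (a - 1) * rexp (-(r * t))) =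
      ENNReal.ofReal ((1 / r) ^ a * Real.Gamma a) := by
  have h := Real.integral_rpow_mul_exp_neg_mul_Ioi ha hr
  rw [← h, ofReal_integral_eq_lintegral_ofReal]
  · refine not_imp_comm.1 integral_undef ?_
    rw [h]
    have := Real.Gamma_pos_of_pos ha
    positivity
  · filter_upwards [ae_restrict_mem measurableSet_Ioi] with t ht
    have : 0 < t := ht
    simp only [Pi.zero_apply]
    positivity

theorem lintegral_rpow_mul_exp_neg_div_Ioi {k r : ℝ} (hk : 0 < k) (hr : 0 < r) :
    ∫⁻ s in Set.Ioi (0 : ℝ), ENNReal.ofReal (s ^ (-k - 1) * rexp (-(r / s))) =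
      ENNReal.ofReal ((1 / r) ^ k * Real.Gamma k) := by
  have h := Real.integral_rpow_mul_exp_neg_mul_Ioi hk hr
  rw [← integral_comp_rpow_Ioi _ (show (-1 : ℝ) ≠ 0 by norm_num)] at h
  have h' : ∫ s in Set.Ioi (0 : ℝ), s ^ (-k - 1) * rexp (-(r / s)) =
      (1 / r) ^ k * Real.Gamma k := by
    rw [← h]
    refine setIntegral_congr_fun measurableSet_Ioi fun s hs => ?_
    have hs : 0 < s := hs
    simp only [abs_neg, abs_one, one_mul, smul_eq_mul]
    rw [← Real.rpow_mul hs.le, ← mul_assoc, ← Real.rpow_add hs, Real.rpow_neg_one]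
    ring_nf
  rw [← h', ofReal_integral_eq_lintegral_ofReal]
  · refine not_imp_comm.1 integral_undef ?_
    rw [h']
    have := Real.Gamma_pos_of_pos hk
    positivity
  · filter_upwards [ae_restrict_mem measurableSet_Ioi] with t ht
    have : 0 < t := ht
    simp only [Pi.zero_apply]
    positivity

theorem lintegral_rpow_mul_one_sub_exp_neg_mul_Ioi {a b : ℝ} (ha : 0 < a) (ha1 : a < 1)
    (hb : 0 ≤ b) :
    ∫⁻ s in Set.Ioi (0 : ℝ), ENNReal.ofReal (s ^ (-a - 1) * (1 - rexp (-(b * s)))) =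
      ENNReal.ofReal (-Real.Gamma (-a) * b ^ a) := by
  have hG : Real.Gamma (1 - a) = -a * Real.Gamma (-a) := by
    rw [← Real.Gamma_add_one (by linarith : -a ≠ 0)]; ring_nf
  have hinner : ∀ s ∈ Set.Ioi (0 : ℝ),
      ENNReal.ofReal (s ^ (-a - 1) * (1 - rexp (-(b * s)))) =
        ∫⁻ u in Set.Ioc 0 b, ENNReal.ofReal (s ^ ((1 - a) - 1) * rexp (-(u * s))) := by
    intro s hs
    have hs : 0 < s := hs
    rw [← ofReal_integral_eq_lintegral_ofReal, ← intervalIntegral.integral_of_le hb]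
    · congr 1
      rw [intervalIntegral.integral_const_mul,
        intervalIntegral.integral_eq_sub_of_hasDerivAt
          (f := fun u => -(rexp (-(u * s)) / s))]
      · rw [show (1 - a) - 1 = (-a - 1) + 1 by ring, Real.rpow_add_one hs.ne']
        field_simp
        simp
        ring
      · intro u _
        have h : HasDerivAt (fun u => -(rexp (-(u * s)) / s))
            (-(rexp (-(u * s)) * -(1 * s) / s)) u :=
          ((((hasDerivAt_id u).mul_const s).neg.exp).div_const s).neg
        exact h.congr_deriv (by field_simp)
      · exact (by fun_prop : Continuous fun u => rexp (-(u * s))).intervalIntegrable _ _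
    · exact (by fun_prop :
        Continuous fun u => s ^ ((1 - a) - 1) * rexp (-(u * s))).integrableOn_Ioc
    · exact Eventually.of_forall fun u => by simp only [Pi.zero_apply]; positivity
  rw [setLIntegral_congr_fun measurableSet_Ioi hinner, lintegral_lintegral_swap (by fun_prop)]
  have houter : ∀ u ∈ Set.Ioc (0 : ℝ) b,
      ∫⁻ s in Set.Ioi (0 : ℝ), ENNReal.ofReal (s ^ ((1 - a) - 1) * rexp (-(u * s))) =
        ENNReal.ofReal (u ^ (a - 1) * Real.Gamma (1 - a)) := by
    intro u hu
    rw [lintegral_rpow_mul_exp_neg_mul_Ioi (by linarith) hu.1, one_div,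
      Real.inv_rpow hu.1.le, ← Real.rpow_neg hu.1.le]
    ring_nf
  rw [setLIntegral_congr_fun measurableSet_Ioc houter, ← ofReal_integral_eq_lintegral_ofReal,
    ← intervalIntegral.integral_of_le hb]
  · congr 1
    rw [intervalIntegral.integral_mul_const, integral_rpow (Or.inl (by linarith)), hG,
      sub_add_cancel, Real.zero_rpow ha.ne']
    field_simp
    ring
  · exact ((intervalIntegrable_iff_integrableOn_Ioc_of_le hb).1
      (intervalIntegral.intervalIntegrable_rpow' (by linarith))).mul_const _
  · filter_upwards [ae_restrict_mem measurableSet_Ioc] with u hu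
    have := hu.1
    have := Real.Gamma_pos_of_pos (by linarith : 0 < 1 - a)
    simp only [Pi.zero_apply]
    positivity

theorem measurableSet_le_norm {V : Type*} [NormedAddCommGroup V] [MeasurableSpace V]
    [OpensMeasurableSpace V] (ε : ℝ) : MeasurableSet {y : V | ε ≤ ‖y‖} :=
  measurableSet_le measurable_const measurable_norm

section

variable {V : Type*} [NormedAddCommGroup V] [InnerProductSpace ℝ V] [FiniteDimensional ℝ V]
  [MeasurableSpace V] [BorelSpace V]

theorem integrable_exp_neg_mul_sq_norm {b : ℝ} (hb : 0 < b) :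
    Integrable fun y : V => rexp (-(b * ‖y‖ ^ 2)) := by
  have h := (GaussianFourier.integrable_cexp_neg_mul_sq_norm_add
    (b := (b : ℂ)) (by simpa) 0 (0 : V)).re
  refine h.congr (Eventually.of_forall fun y => ?_)
  have : (-(b : ℂ) * (‖y‖ : ℂ) ^ 2 + 0 * (inner ℝ (0 : V) y : ℂ)) =
    ((-(b * ‖y‖ ^ 2) : ℝ) : ℂ) := by push_cast; ring
  simp only [this, ← Complex.ofReal_exp, RCLike.re_to_complex, Complex.ofReal_re]

theorem integral_exp_neg_mul_sq_norm_mul_cos {b : ℝ} (hb : 0 < b) (ξ : V) :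
    ∫ y : V, rexp (-(b * ‖y‖ ^ 2)) * Real.cos (2 * π * inner ℝ y ξ) =
      (π / b) ^ (Module.finrank ℝ V / 2 : ℝ) * rexp (-(π ^ 2 * ‖ξ‖ ^ 2 / b)) := by
  have hb' : 0 < (b : ℂ).re := by simpa
  have h := GaussianFourier.integral_cexp_neg_mul_sq_norm_add hb' (2 * π * Complex.I) ξ
  have hi := GaussianFourier.integrable_cexp_neg_mul_sq_norm_add hb' (2 * π * Complex.I) ξ
  have hr := congrArg Complex.re h
  rw [← RCLike.re_to_complex, ← integral_re hi] at hr
  convert hr using 1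
  · refine integral_congr_ae (Eventually.of_forall fun y => ?_)
    simp only [RCLike.re_to_complex]
    rw [Complex.exp_re]
    congr 2
    · simp [← Complex.ofReal_pow]
    · simp [← Complex.ofReal_pow, real_inner_comm]
  · have e1 : ((π : ℂ) / b) ^ ((Module.finrank ℝ V : ℂ) / 2) =
        (((π / b) ^ (Module.finrank ℝ V / 2 : ℝ) : ℝ) : ℂ) := by
      rw [Complex.ofReal_cpow (by positivity)]; push_cast; rfl
    have e2 : (2 * π * Complex.I) ^ 2 * (‖ξ‖ : ℂ) ^ 2 / (4 * b) =
        ((-(π ^ 2 * ‖ξ‖ ^ 2 / b) : ℝ) : ℂ) := by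
      rw [mul_pow, Complex.I_sq]; push_cast; field_simp; ring
    rw [e1, e2, ← Complex.ofReal_exp, ← Complex.ofReal_mul, Complex.ofReal_re]

theorem lintegral_one_sub_cos_mul_exp_neg_mul_sq_norm {b : ℝ} (hb : 0 < b) (ξ : V) :
    ∫⁻ y : V, ENNReal.ofReal ((1 - Real.cos (2 * π * inner ℝ y ξ)) * rexp (-(b * ‖y‖ ^ 2))) =
      ENNReal.ofReal ((π / b) ^ (Module.finrank ℝ V / 2 : ℝ) *
        (1 - rexp (-(π ^ 2 * ‖ξ‖ ^ 2 / b)))) := by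
  have hi := integrable_exp_neg_mul_sq_norm (V := V) hb
  have hc : Integrable fun y : V => rexp (-(b * ‖y‖ ^ 2)) * Real.cos (2 * π * inner ℝ y ξ) := by
    refine hi.mul_bdd (c := 1) (by fun_prop) (Eventually.of_forall fun y => ?_)
    simpa using Real.abs_cos_le_one _
  have h0 : ∫ y : V, rexp (-(b * ‖y‖ ^ 2)) = (π / b) ^ (Module.finrank ℝ V / 2 : ℝ) := by
    simpa using integral_exp_neg_mul_sq_norm_mul_cos hb (0 : V)
  have heq : (fun y : V => (1 - Real.cos (2 * π * inner ℝ y ξ)) * rexp (-(b * ‖y‖ ^ 2))) =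
      fun y => rexp (-(b * ‖y‖ ^ 2)) -
        rexp (-(b * ‖y‖ ^ 2)) * Real.cos (2 * π * inner ℝ y ξ) := by
    ext y; ring
  rw [← ofReal_integral_eq_lintegral_ofReal]
  · rw [heq, integral_sub hi hc, h0, integral_exp_neg_mul_sq_norm_mul_cos hb]
    ring_nf
  · rw [heq]; exact hi.sub hc
  · exact Eventually.of_forall fun y =>
      mul_nonneg (sub_nonneg.2 (Real.cos_le_one _)) (exp_pos _).le

/-- The Lévy–Khintchine integral of the symmetric stable law. -/
theorem lintegral_one_sub_cos_mul_norm_rpow {α : ℝ} (hα : 0 < α) (hα2 : α < 2) (ξ : V) :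
    ∫⁻ y : V, ENNReal.ofReal ((1 - Real.cos (2 * π * inner ℝ y ξ)) /
        ‖y‖ ^ ((Module.finrank ℝ V : ℝ) + α)) =
      ENNReal.ofReal (-(π ^ ((Module.finrank ℝ V : ℝ) / 2) * 2 ^ (-α) * Real.Gamma (-α / 2) /
          Real.Gamma (((Module.finrank ℝ V : ℝ) + α) / 2)) * (2 * π * ‖ξ‖) ^ α) := by
  set d : ℝ := (Module.finrank ℝ V : ℝ)
  have hd : 0 ≤ d := Nat.cast_nonneg _
  set k : ℝ := (d + α) / 2
  have hk : 0 < k := by positivity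
  have hG := Real.Gamma_pos_of_pos hk
  have h1 : ∀ y : V, ENNReal.ofReal ((1 - Real.cos (2 * π * inner ℝ y ξ)) / ‖y‖ ^ (d + α)) =
      ENNReal.ofReal (1 / Real.Gamma k) * ∫⁻ s in Set.Ioi (0 : ℝ),
        ENNReal.ofReal (s ^ (-k - 1)) * ENNReal.ofReal
          ((1 - Real.cos (2 * π * inner ℝ y ξ)) * rexp (-(1 / s * ‖y‖ ^ 2))) := by
    intro y
    have hcos : 0 ≤ 1 - Real.cos (2 * π * inner ℝ y ξ) := sub_nonneg.2 (Real.cos_le_one _)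
    rcases eq_or_ne y 0 with rfl | hy
    · simp
    have hy : 0 < ‖y‖ := norm_pos_iff.2 hy
    have e : ∀ s ∈ Set.Ioi (0 : ℝ), ENNReal.ofReal (s ^ (-k - 1)) * ENNReal.ofReal
          ((1 - Real.cos (2 * π * inner ℝ y ξ)) * rexp (-(1 / s * ‖y‖ ^ 2))) =
        ENNReal.ofReal (1 - Real.cos (2 * π * inner ℝ y ξ)) *
          ENNReal.ofReal (s ^ (-k - 1) * rexp (-(‖y‖ ^ 2 / s))) := by
      intro s hs
      have hs : 0 < s := hs
      rw [← ENNReal.ofReal_mul (by positivity), ← ENNReal.ofReal_mul hcos]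
      ring_nf
    rw [setLIntegral_congr_fun measurableSet_Ioi e, lintegral_const_mul _ (by fun_prop),
      lintegral_rpow_mul_exp_neg_div_Ioi hk (by positivity), ← ENNReal.ofReal_mul hcos,
      ← ENNReal.ofReal_mul (by positivity)]
    congr 1
    rw [one_div (‖y‖ ^ 2), Real.inv_rpow (by positivity), ← Real.rpow_natCast,
      ← Real.rpow_mul hy.le, show ((2 : ℕ) : ℝ) * k = d + α by simp only [k]; push_cast; ring]
    field_simp
  have h2 : ∀ s ∈ Set.Ioi (0 : ℝ), ∫⁻ y : V, ENNReal.ofReal (s ^ (-k - 1)) * ENNReal.ofReal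
          ((1 - Real.cos (2 * π * inner ℝ y ξ)) * rexp (-(1 / s * ‖y‖ ^ 2))) =
      ENNReal.ofReal (π ^ (d / 2)) * ENNReal.ofReal
        (s ^ (-(α / 2) - 1) * (1 - rexp (-(π ^ 2 * ‖ξ‖ ^ 2 * s)))) := by
    intro s hs
    have hs : 0 < s := hs
    rw [lintegral_const_mul _ (by fun_prop),
      lintegral_one_sub_cos_mul_exp_neg_mul_sq_norm (by positivity),
      ← ENNReal.ofReal_mul (by positivity), ← ENNReal.ofReal_mul (by positivity)]
    congr 1
    rw [div_div_eq_mul_div, div_one, div_div_eq_mul_div, div_one, Real.mul_rpow pi_pos.le hs.le,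
      show -(α / 2) - 1 = (-k - 1) + d / 2 by simp only [k]; ring, Real.rpow_add hs]
    ring
  simp_rw [h1]
  rw [lintegral_const_mul' _ _ ENNReal.ofReal_ne_top, lintegral_lintegral_swap (by fun_prop),
    setLIntegral_congr_fun measurableSet_Ioi h2, lintegral_const_mul _ (by fun_prop),
    lintegral_rpow_mul_one_sub_exp_neg_mul_Ioi (by positivity) (by linarith) (by positivity),
    ← ENNReal.ofReal_mul (by positivity), ← ENNReal.ofReal_mul (by positivity)]
  congr 1
  rw [← mul_pow, ← Real.rpow_natCast, ← Real.rpow_mul (by positivity),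
    show ((2 : ℕ) : ℝ) * (α / 2) = α by push_cast; ring, mul_assoc 2 π,
    Real.mul_rpow (x := 2) (by norm_num) (by positivity), Real.rpow_neg (by norm_num), neg_div]
  field_simp

theorem integrable_one_sub_cos_div_norm_rpow {α : ℝ} (hα : 0 < α) (hα2 : α < 2) (ξ : V) :
    Integrable fun y : V => (1 - Real.cos (2 * π * inner ℝ y ξ)) /
        ‖y‖ ^ ((Module.finrank ℝ V : ℝ) + α) := by
  refine (lintegral_ofReal_ne_top_iff_integrable ?_ ?_).1 ?_
  · exact Measurable.aestronglyMeasurable (by fun_prop)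
  · exact Eventually.of_forall fun y =>
      div_nonneg (sub_nonneg.2 (Real.cos_le_one _)) (by positivity)
  · rw [lintegral_one_sub_cos_mul_norm_rpow hα hα2]
    exact ENNReal.ofReal_ne_top

theorem integral_one_sub_cos_div_norm_rpow {α : ℝ} (hα : 0 < α) (hα2 : α < 2) (ξ : V) :
    ∫ y : V, (1 - Real.cos (2 * π * inner ℝ y ξ)) / ‖y‖ ^ ((Module.finrank ℝ V : ℝ) + α) =
      -(π ^ ((Module.finrank ℝ V : ℝ) / 2) * 2 ^ (-α) * Real.Gamma (-α / 2) /
          Real.Gamma (((Module.finrank ℝ V : ℝ) + α) / 2)) * (2 * π * ‖ξ‖) ^ α := by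
  have hG : Real.Gamma (-α / 2) ≤ 0 :=
    (Gamma_neg_of_neg_one_lt_of_neg (by linarith) (by linarith)).le
  have hG' := Real.Gamma_pos_of_pos (by positivity : 0 < ((Module.finrank ℝ V : ℝ) + α) / 2)
  rw [integral_eq_lintegral_of_nonneg_ae, lintegral_one_sub_cos_mul_norm_rpow hα hα2,
    ENNReal.toReal_ofReal]
  · refine mul_nonneg (neg_nonneg.2 (div_nonpos_of_nonpos_of_nonneg
      (mul_nonpos_of_nonneg_of_nonpos (by positivity) hG) hG'.le)) (by positivity)
  · exact Eventually.of_forall fun y =>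
      div_nonneg (sub_nonneg.2 (Real.cos_le_one _)) (by positivity)
  · exact (integrable_one_sub_cos_div_norm_rpow hα hα2 ξ).aestronglyMeasurable

theorem integrableOn_inv_norm_rpow {r ε : ℝ} (hr : (Module.finrank ℝ V : ℝ) < r) (hε : 0 < ε) :
    IntegrableOn (fun y : V => (‖y‖ ^ r)⁻¹) {y | ε ≤ ‖y‖} := by
  have hr0 : 0 < r := (Nat.cast_nonneg _).trans_lt hr
  refine (((integrable_one_add_norm (μ := (volume : Measure V)) hr).const_mul
    ((1 / ε + 1) ^ r)).integrableOn (s := {y | ε ≤ ‖y‖})).mono'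
    (Measurable.aestronglyMeasurable (by fun_prop)) ?_
  filter_upwards [ae_restrict_mem (measurableSet_le_norm ε)] with y hy
  have hy : ε ≤ ‖y‖ := hy
  have hy0 : 0 < ‖y‖ := hε.trans_le hy
  rw [Real.norm_of_nonneg (by positivity), Real.rpow_neg (by positivity), ← div_eq_mul_inv,
    le_div_iff₀ (by positivity), ← div_eq_inv_mul, div_le_iff₀ (by positivity),
    ← Real.mul_rpow (by positivity) hy0.le]
  refine Real.rpow_le_rpow (by positivity) ?_ hr0.le
  have : 1 ≤ 1 / ε * ‖y‖ := by
    rw [one_div, ← div_eq_inv_mul, one_le_div hε]; exact hy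
  linarith

theorem norm_exp_mul_I_sub_one_div_le (t k : ℝ) (hk : 0 ≤ k) :
    ‖(Complex.exp ((t : ℂ) * Complex.I) - 1) / (k : ℂ)‖ ≤ 2 * k⁻¹ := by
  rw [norm_div, Complex.norm_real, Real.norm_of_nonneg hk, div_eq_mul_inv]
  gcongr
  refine (norm_sub_le _ _).trans ?_
  rw [Complex.norm_exp_ofReal_mul_I, norm_one]
  norm_num

theorem setIntegral_exp_sub_one_div_norm_rpow {r ε : ℝ} (hr : (Module.finrank ℝ V : ℝ) < r)
    (hε : 0 < ε) (ξ : V) :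
    ∫ y in {y : V | ε ≤ ‖y‖},
        (Complex.exp (((2 * π * inner ℝ y ξ : ℝ) : ℂ) * Complex.I) - 1) / ((‖y‖ ^ r : ℝ) : ℂ) =
      ((-∫ y in {y : V | ε ≤ ‖y‖}, (1 - Real.cos (2 * π * inner ℝ y ξ)) / ‖y‖ ^ r : ℝ) : ℂ) := by
  set g : V → ℂ := fun y =>
    (Complex.exp (((2 * π * inner ℝ y ξ : ℝ) : ℂ) * Complex.I) - 1) / ((‖y‖ ^ r : ℝ) : ℂ) with hg
  have hgi : IntegrableOn g {y | ε ≤ ‖y‖} :=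
    ((integrableOn_inv_norm_rpow hr hε).const_mul 2).mono'
      (Measurable.aestronglyMeasurable (by fun_prop))
      (Eventually.of_forall fun y => norm_exp_mul_I_sub_one_div_le _ _ (by positivity))
  have hneg : ∫ y in {y : V | ε ≤ ‖y‖}, g (-y) = ∫ y in {y : V | ε ≤ ‖y‖}, g y := by
    have h := (Measure.measurePreserving_neg (volume : Measure V)).setIntegral_preimage_emb
      (MeasurableEquiv.neg V).measurableEmbedding g {y | ε ≤ ‖y‖}
    simpa using h
  have hconj : ∀ y, g (-y) = (starRingEnd ℂ) (g y) := by
    intro y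
    simp only [hg, map_div₀, map_sub, map_one, Complex.conj_ofReal, ← Complex.exp_conj, map_mul,
      Complex.conj_I, inner_neg_left, norm_neg]
    congr 3
    push_cast
    ring
  simp_rw [hconj] at hneg
  rw [integral_conj] at hneg
  rw [← Complex.conj_eq_iff_re.1 hneg, ← RCLike.re_to_complex, ← integral_re hgi, ← integral_neg]
  congr 2
  ext y
  simp only [hg, RCLike.re_to_complex, Complex.div_ofReal_re, Complex.sub_re,
    Complex.exp_ofReal_mul_I_re, Complex.one_re]
  ring

theorem tendsto_setIntegral_le_norm {g : V → ℝ} (hg : Integrable g) (h0 : g 0 = 0) :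
    Tendsto (fun ε : ℝ => ∫ y in {y : V | ε ≤ ‖y‖}, g y) (𝓝[>] 0) (𝓝 (∫ y, g y)) := by
  have hind : ∀ ε : ℝ, ∫ y in {y : V | ε ≤ ‖y‖}, g y =
      ∫ y, {y : V | ε ≤ ‖y‖}.indicator g y :=
    fun ε => (integral_indicator (measurableSet_le_norm ε)).symm
  simp_rw [hind]
  refine tendsto_integral_filter_of_dominated_convergence (fun y => ‖g y‖)
    (Eventually.of_forall fun ε => hg.aestronglyMeasurable.indicator (measurableSet_le_norm ε))
    (Eventually.of_forall fun ε => Eventually.of_forall fun y => norm_indicator_le_norm_self _ _)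
    hg.norm (Eventually.of_forall fun y => tendsto_const_nhds.congr' ?_)
  rcases eq_or_ne y 0 with rfl | hy
  · exact Eventually.of_forall fun ε => by simp [Set.indicator_apply, h0]
  · filter_upwards [Ioo_mem_nhdsGT (norm_pos_iff.2 hy)] with ε hε
    rw [Set.indicator_of_mem]
    exact hε.2.le

theorem setIntegral_sub_div_norm_rpow_eq {r ε : ℝ} (hr : (Module.finrank ℝ V : ℝ) < r)
    (hε : 0 < ε) (f : SchwartzMap V ℂ) (x : V) :
    Integrable (fun ξ : V => Complex.exp (((2 * π * inner ℝ ξ x : ℝ) : ℂ) * Complex.I) * 𝓕 f ξ *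
      ((-∫ y in {y : V | ε ≤ ‖y‖}, (1 - Real.cos (2 * π * inner ℝ y ξ)) / ‖y‖ ^ r : ℝ) : ℂ)) ∧
    ∫ y in {y : V | ε ≤ ‖y‖}, (f (x + y) - f x) / ((‖y‖ ^ r : ℝ) : ℂ) =
      ∫ ξ : V, Complex.exp (((2 * π * inner ℝ ξ x : ℝ) : ℂ) * Complex.I) * 𝓕 f ξ *
      ((-∫ y in {y : V | ε ≤ ‖y‖}, (1 - Real.cos (2 * π * inner ℝ y ξ)) / ‖y‖ ^ r : ℝ) : ℂ) := by
  have hF : Integrable ⇑(𝓕 f : SchwartzMap V ℂ) := (𝓕 f).integrable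
  have hFm : Measurable ⇑(𝓕 f : SchwartzMap V ℂ) := (𝓕 f).continuous.measurable
  have hexp : ∀ z : V, Integrable fun ξ : V =>
      Complex.exp (((2 * π * inner ℝ ξ z : ℝ) : ℂ) * Complex.I) * 𝓕 f ξ := fun z =>
    hF.norm.mono' (Measurable.aestronglyMeasurable (by fun_prop)) (Eventually.of_forall fun ξ => by
      rw [norm_mul, Complex.norm_exp_ofReal_mul_I, one_mul])
  have hinv : ∀ z : V, f z = ∫ ξ : V,
      Complex.exp (((2 * π * inner ℝ ξ z : ℝ) : ℂ) * Complex.I) * 𝓕 f ξ := by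
    intro z
    have h : (𝓕⁻ (𝓕 f : SchwartzMap V ℂ) : SchwartzMap V ℂ) = f :=
      FourierTransform.fourierInv_fourier_eq f
    conv_lhs => rw [← h, SchwartzMap.fourierInv_coe, Real.fourierInv_eq']
    rfl
  set G : V → V → ℂ := fun y ξ =>
    Complex.exp (((2 * π * inner ℝ ξ x : ℝ) : ℂ) * Complex.I) * 𝓕 f ξ *
      ((Complex.exp (((2 * π * inner ℝ y ξ : ℝ) : ℂ) * Complex.I) - 1) / ((‖y‖ ^ r : ℝ) : ℂ))
    with hG
  have hGi : Integrable (Function.uncurry G)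
      ((volume.restrict {y : V | ε ≤ ‖y‖}).prod volume) := by
    refine (((integrableOn_inv_norm_rpow hr hε).const_mul 2).mul_prod hF.norm).mono'
      (Measurable.aestronglyMeasurable (by fun_prop)) (Eventually.of_forall fun p => ?_)
    simp only [Function.uncurry, hG]
    rw [norm_mul, norm_mul, Complex.norm_exp_ofReal_mul_I, one_mul, mul_comm]
    gcongr
    exact norm_exp_mul_I_sub_one_div_le _ _ (by positivity)
  have hinner : ∀ ξ : V, ∫ y in {y : V | ε ≤ ‖y‖}, G y ξ =
      Complex.exp (((2 * π * inner ℝ ξ x : ℝ) : ℂ) * Complex.I) * 𝓕 f ξ *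
      ((-∫ y in {y : V | ε ≤ ‖y‖}, (1 - Real.cos (2 * π * inner ℝ y ξ)) / ‖y‖ ^ r : ℝ) : ℂ) := by
    intro ξ
    rw [← setIntegral_exp_sub_one_div_norm_rpow hr hε, ← integral_const_mul]
  constructor
  · simp_rw [← hinner]
    exact hGi.integral_prod_right
  · simp_rw [← hinner]
    rw [← integral_integral_swap hGi]
    congr 1
    ext y
    rw [hinv (x + y), hinv x, ← integral_sub (hexp _) (hexp _), ← integral_div]
    congr 1
    ext ξ
    simp only [hG]
    rw [inner_add_right, mul_add, Complex.ofReal_add, add_mul, Complex.exp_add,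
      real_inner_comm ξ y]
    ring

theorem integrable_norm_rpow_mul_norm {α : ℝ} (hα : 0 < α) (hα2 : α < 2) (g : SchwartzMap V ℂ) :
    Integrable fun ξ : V => (2 * π * ‖ξ‖) ^ α * ‖g ξ‖ := by
  have h2 := g.integrable_pow_mul volume 2
  refine ((g.integrable.norm.add h2).const_mul ((2 * π) ^ α)).mono'
    (Measurable.aestronglyMeasurable
      (by have := g.continuous.measurable; fun_prop)) (Eventually.of_forall fun ξ => ?_)
  rw [Real.norm_of_nonneg (by positivity), Real.mul_rpow (by positivity) (by positivity),
    mul_assoc]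
  have h : ‖ξ‖ ^ α ≤ 1 + ‖ξ‖ ^ 2 := by
    rcases le_total ‖ξ‖ 1 with h | h
    · have := Real.rpow_le_one (norm_nonneg ξ) h hα.le
      nlinarith [sq_nonneg ‖ξ‖]
    · have := Real.rpow_le_rpow_of_exponent_le h hα2.le
      rw [Real.rpow_two] at this
      linarith
  gcongr
  calc ‖ξ‖ ^ α * ‖g ξ‖ ≤ (1 + ‖ξ‖ ^ 2) * ‖g ξ‖ := by gcongr
    _ = _ := by simp only [Pi.add_apply]; ring

end

/-- For `α ∈ (0,2)` and `f` Schwartz on `ℝⁿ`,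
`D^α f(x) = lim_{ε→0⁺} c_{n,α}⁻¹ ∫_{|y|≥ε} (f(x+y) - f(x)) / |y|^{n+α} dy`,
where `c_{n,α} = π^{n/2} 2^{-α} Γ(-α/2) / Γ((n+α)/2)`. -/
theorem fracD_eq_singular_integral {n : ℕ} (hn : 0 < n) (α : ℝ)
    (hα : α ∈ Set.Ioo (0 : ℝ) 2)
    (f : SchwartzMap (EuclideanSpace ℝ (Fin n)) ℂ)
    (c : ℝ)
    (hc : c = Real.pi ^ ((n : ℝ) / 2) * 2 ^ (-α) * Real.Gamma (-α / 2) /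
          Real.Gamma (((n : ℝ) + α) / 2))
    (x : EuclideanSpace ℝ (Fin n)) :
    Tendsto (fun ε : ℝ =>
        (1 / (c : ℂ)) *
          ∫ y in {y : EuclideanSpace ℝ (Fin n) | ε ≤ ‖y‖},
            (f (x + y) - f x) / ((‖y‖ ^ ((n : ℝ) + α) : ℝ) : ℂ))
      (𝓝[>] 0) (𝓝 (fracD α (⇑f) x)) := by
  have hα0 : 0 < α := hα.1
  have hα2 : α < 2 := hα.2
  have hd : (Module.finrank ℝ (EuclideanSpace ℝ (Fin n)) : ℝ) = n := by simp
  have hr : (Module.finrank ℝ (EuclideanSpace ℝ (Fin n)) : ℝ) < n + α := by rw [hd]; linarith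
  set m : EuclideanSpace ℝ (Fin n) → EuclideanSpace ℝ (Fin n) → ℝ := fun ξ y =>
    (1 - Real.cos (2 * π * inner ℝ y ξ)) / ‖y‖ ^ ((n : ℝ) + α)
    with hm
  have hm0 : ∀ ξ y, 0 ≤ m ξ y := fun ξ y =>
    div_nonneg (sub_nonneg.2 (Real.cos_le_one _)) (by positivity)
  have hmi : ∀ ξ, Integrable (m ξ) := fun ξ => by
    simpa only [hd] using integrable_one_sub_cos_div_norm_rpow hα0 hα2 ξ
  have hmv : ∀ ξ, ∫ y, m ξ y = -c * (2 * π * ‖ξ‖) ^ α := fun ξ => by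
    rw [hc]
    simpa only [hd] using integral_one_sub_cos_div_norm_rpow hα0 hα2 ξ
  have hc0 : c ≠ 0 := by
    have h1 := (Gamma_neg_of_neg_one_lt_of_neg (by linarith : -1 < -α / 2) (by linarith)).ne
    have h2 := Real.Gamma_pos_of_pos (by positivity : 0 < ((n : ℝ) + α) / 2)
    rw [hc]
    positivity
  set E : EuclideanSpace ℝ (Fin n) → ℂ := fun ξ =>
    Complex.exp (((2 * π * inner ℝ ξ x : ℝ) : ℂ) * Complex.I) * 𝓕 f ξ
    with hE
  have hEn : ∀ ξ, ‖E ξ‖ = ‖𝓕 f ξ‖ := fun ξ => by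
    rw [hE, norm_mul, Complex.norm_exp_ofReal_mul_I, one_mul]
  have hlim : Tendsto (fun ε : ℝ =>
      ∫ ξ, E ξ * ((-∫ y in {y : EuclideanSpace ℝ (Fin n) | ε ≤ ‖y‖}, m ξ y : ℝ) : ℂ))
      (𝓝[>] 0) (𝓝 (∫ ξ, E ξ * ((-∫ y, m ξ y : ℝ) : ℂ))) := by
    refine tendsto_integral_filter_of_dominated_convergence
      (fun ξ => -c * ((2 * π * ‖ξ‖) ^ α * ‖𝓕 f ξ‖)) ?_ ?_ ?_ ?_
    · filter_upwards [self_mem_nhdsWithin] with ε hε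
      exact (setIntegral_sub_div_norm_rpow_eq hr hε f x).1.aestronglyMeasurable
    · refine Eventually.of_forall fun ε => Eventually.of_forall fun ξ => ?_
      rw [norm_mul, hEn, ← mul_assoc, ← hmv, mul_comm, Complex.norm_real, norm_neg,
        Real.norm_of_nonneg (integral_nonneg fun y => hm0 ξ y)]
      exact mul_le_mul_of_nonneg_right
        (setIntegral_le_integral (hmi ξ) (Eventually.of_forall (hm0 ξ))) (norm_nonneg _)
    · exact (integrable_norm_rpow_mul_norm hα0 hα2 (𝓕 f)).const_mul _
    · refine Eventually.of_forall fun ξ => Tendsto.const_mul _ ?_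
      exact (Complex.continuous_ofReal.tendsto _).comp
        (tendsto_setIntegral_le_norm (hmi ξ) (by simp [hm])).neg
  have hD : fracD α (⇑f) x = (1 / (c : ℂ)) * ∫ ξ, E ξ * ((-∫ y, m ξ y : ℝ) : ℂ) := by
    rw [fracD, Real.fourierInv_eq', ← integral_const_mul]
    congr 1
    ext ξ
    have hcc : (c : ℂ) ≠ 0 := Complex.ofReal_ne_zero.2 hc0
    rw [hmv, smul_eq_mul, hE, SchwartzMap.fourier_coe, neg_mul, neg_neg, Complex.ofReal_mul c]
    field_simp
  rw [hD]
  refine Tendsto.const_mul _ (hlim.congr' ?_)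
  filter_upwards [self_mem_nhdsWithin] with ε hε
  exact (setIntegral_sub_div_norm_rpow_eq hr hε f x).2.symm
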